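/- Let (a_n)_{n≥1} be a sequence of distinct positive real numbers with inf_{m≠n} |a_m − a_n| ≥ c for some constant c > 0, and let ε > 0. Let f be a differentiable function on [inf_n a_n, ∞) with f(a_n) > 0 for all n, and suppose there exists δ₀ > 0 such that |f'(x)| ≥ δ₀ for all x ∈ [inf_n a_n, ∞). Then for almost all α ∈ [0,1] there exists N₀(α) such that for all N ≥ N₀(α): δ_min^α for the sequence (f(a_n))_{n≥1} satisfies δ_min^α(N) ≥ 1 / (D̃_N · log N · (log₂ N)^{1+ε}) and δ_min^α(N) ≤ 1 − 1 / (D̃_N · log N · (log₂ N)^{1+ε}), where D̃_N = #{|f(a_m) − f(a_n)| : 1 ≤ m ≠ n ≤ N}. -/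

import Mathlib

open MeasureTheory Filter

/-- Distance from a real number to the nearest integer. -/
noncomputable def nint (x : ℝ) : ℝ := |x - round x|

/-- `deltaMin a α N` is the minimal gap
`min { ‖α (a_m − a_n)‖ : 1 ≤ m ≠ n ≤ N }`. -/
noncomputable def deltaMin (a : ℕ → ℝ) (α : ℝ) (N : ℕ) : ℝ :=
  sInf {d : ℝ | ∃ m n : ℕ, 1 ≤ m ∧ m ≤ N ∧ 1 ≤ n ∧ n ≤ N ∧ m ≠ n ∧
    d = nint (α * (a m - a n))}

/-- `Dcard a N` is the number of distinct positive differences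
`#{ |a_m − a_n| : 1 ≤ m ≠ n ≤ N }`. -/
noncomputable def Dcard (a : ℕ → ℝ) (N : ℕ) : ℕ :=
  Set.ncard {x : ℝ | ∃ m n : ℕ, 1 ≤ m ∧ m ≤ N ∧ 1 ≤ n ∧ n ≤ N ∧ m ≠ n ∧
    x = |a m - a n|}

/-- `Log x = max (1, log x)`. -/
noncomputable def Log (x : ℝ) : ℝ := max 1 (Real.log x)

/-- Iterated logarithm `log₂ x = Log (Log x)`. -/
noncomputable def Log2 (x : ℝ) : ℝ := Log (Log x)

/-- The infimum `inf_{n ≥ 1} a_n` of the terms of the sequence. -/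
noncomputable def seqInf (a : ℕ → ℝ) : ℝ := sInf {x : ℝ | ∃ n : ℕ, 1 ≤ n ∧ x = a n}

lemma one_le_Log (x : ℝ) : 1 ≤ Log x := le_max_left _ _

lemma Log_pos (x : ℝ) : 0 < Log x := one_pos.trans_le (one_le_Log x)

lemma one_le_Log2 (x : ℝ) : 1 ≤ Log2 x := one_le_Log _

lemma Log2_pos (x : ℝ) : 0 < Log2 x := Log_pos _

lemma Log_mono {x y : ℝ} (hx : 0 ≤ x) (hxy : x ≤ y) : Log x ≤ Log y := by
  rcases hx.eq_or_lt with rfl | hx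
  · simp [Log]
  · exact max_le_max le_rfl (Real.log_le_log hx hxy)

lemma Log2_mono {x y : ℝ} (hx : 0 ≤ x) (hxy : x ≤ y) : Log2 x ≤ Log2 y :=
  Log_mono (Log_pos x).le (Log_mono hx hxy)

lemma Log_le_two_mul_Log_half {x : ℝ} (hx : 0 < x) : Log x ≤ 2 * Log (x / 2) := by
  have h1 := one_le_Log (x / 2)
  have h2 : Real.log (x / 2) ≤ Log (x / 2) := le_max_right _ _
  rw [Real.log_div hx.ne' two_ne_zero] at h2
  have h3 : Real.log 2 ≤ 1 := by linarith [Real.log_two_lt_d9]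
  exact max_le (by linarith) (by linarith)

lemma half_le_Log_two_pow (k : ℕ) : (k : ℝ) / 2 ≤ Log ((2 : ℝ) ^ k) := by
  refine le_trans ?_ (le_max_right _ _)
  rw [Real.log_pow]
  have h : (1 : ℝ) / 2 ≤ Real.log 2 := by linarith [Real.log_two_gt_d9]
  have : (0 : ℝ) ≤ k := k.cast_nonneg
  nlinarith

lemma Log_sq_le (x : ℝ) : Log (x * x) ≤ 2 * Log x := by
  have h1 := one_le_Log x
  have h2 : Real.log x ≤ Log x := le_max_right _ _
  refine max_le (by linarith) ?_
  by_cases hx : x = 0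
  · subst hx; simp; linarith
  · rw [Real.log_mul hx hx]; linarith

lemma Log2_sq_le (x : ℝ) : Log2 (x * x) ≤ 2 * Log2 x := by
  refine (Log_mono (Log_pos _).le (Log_sq_le x)).trans ?_
  have := Log_le_two_mul_Log_half (x := 2 * Log x) (by linarith [Log_pos x])
  simpa [Log2] using this

lemma summable_one_div_mul_Log_rpow {ε : ℝ} (hε : 0 < ε) :
    Summable fun k : ℕ => 1 / ((k : ℝ) * Log k ^ (1 + ε)) := by
  have hL (k : ℕ) : 0 < Log (k : ℝ) ^ (1 + ε) := Real.rpow_pos_of_pos (Log_pos _) _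
  rw [← summable_condensed_iff_of_nonneg]
  · refine Summable.of_norm_bounded_eventually_nat
      (g := fun k : ℕ => 2 ^ (1 + ε) * (1 / (k : ℝ) ^ (1 + ε)))
      ((Real.summable_one_div_nat_rpow.2 (by linarith)).mul_left _) ?_
    filter_upwards [eventually_ge_atTop 1] with k hk
    have hk' : (0 : ℝ) < k := by exact_mod_cast hk
    have h2 : (0 : ℝ) < 2 ^ k := by positivity
    have e : (2 : ℝ) ^ k * (1 / (((2 ^ k : ℕ) : ℝ) * Log ((2 ^ k : ℕ) : ℝ) ^ (1 + ε)))
        = 1 / Log ((2 : ℝ) ^ k) ^ (1 + ε) := by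
      push_cast
      field_simp
    rw [e, Real.norm_of_nonneg (by have := Log_pos ((2 : ℝ) ^ k); positivity)]
    have : (2 : ℝ) ^ (1 + ε) * (1 / (k : ℝ) ^ (1 + ε)) = 1 / ((k : ℝ) / 2) ^ (1 + ε) := by
      rw [Real.div_rpow hk'.le two_pos.le]
      field_simp
    rw [this]
    gcongr
    exact half_le_Log_two_pow k
  · intro k
    have := hL k
    positivity
  · intro m n hm hmn
    have := hL m
    have hm' : (0 : ℝ) < m := by exact_mod_cast hm
    have := Log_pos (m : ℝ)
    have hmn' : (m : ℝ) ≤ n := by exact_mod_cast hmn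
    have := Log_mono hm'.le hmn'
    gcongr

/-- The gap threshold `1 / (D log x (log₂ x)^{1+ε})`. -/
noncomputable def gapBound (ε D x : ℝ) : ℝ := 1 / (D * Log x * Log2 x ^ (1 + ε))

lemma gapBound_nonneg (ε x : ℝ) {D : ℝ} (hD : 0 ≤ D) : 0 ≤ gapBound ε D x := by
  have := Log_pos x
  have := Log2_pos x
  unfold gapBound
  positivity

lemma gapBound_anti {ε D D' x y : ℝ} (hε : 0 < ε) (hD : 0 < D) (hDD : D ≤ D') (hx : 0 ≤ x)
    (hxy : x ≤ y) : gapBound ε D' y ≤ gapBound ε D x := by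
  have := hD.trans_le hDD
  have := Log_pos y
  have := Log_pos x
  have := Log2_pos x
  have := Log_mono hx hxy
  have := Log2_mono hx hxy
  unfold gapBound
  gcongr

lemma summable_gapBound_self {ε : ℝ} (hε : 0 < ε) :
    Summable fun k : ℕ => gapBound ε k k := by
  rw [← summable_condensed_iff_of_nonneg]
  · refine Summable.of_norm_bounded_eventually_nat
      (g := fun k : ℕ => (2 * 2 ^ (1 + ε)) * (1 / ((k : ℝ) * Log k ^ (1 + ε))))
      ((summable_one_div_mul_Log_rpow hε).mul_left _) ?_
    filter_upwards [eventually_ge_atTop 1] with k hk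
    have hk' : (0 : ℝ) < k := by exact_mod_cast hk
    have h2 : (0 : ℝ) < 2 ^ k := by positivity
    have hL := Log_pos ((2 : ℝ) ^ k)
    have hL2 := Log2_pos ((2 : ℝ) ^ k)
    have hLk := Log_pos (k : ℝ)
    have e : (2 : ℝ) ^ k * gapBound ε ((2 ^ k : ℕ) : ℝ) ((2 ^ k : ℕ) : ℝ)
        = 1 / (Log ((2 : ℝ) ^ k) * Log2 ((2 : ℝ) ^ k) ^ (1 + ε)) := by
      unfold gapBound
      push_cast
      field_simp
    rw [e, Real.norm_of_nonneg (by positivity)]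
    have : (2 * 2 ^ (1 + ε)) * (1 / ((k : ℝ) * Log k ^ (1 + ε)))
        = 1 / (((k : ℝ) / 2) * (Log k / 2) ^ (1 + ε)) := by
      rw [Real.div_rpow hLk.le two_pos.le]
      field_simp
    rw [this]
    have h3 := half_le_Log_two_pow k
    have h4 : Log (k : ℝ) / 2 ≤ Log2 ((2 : ℝ) ^ k) := by
      have h5 := Log_le_two_mul_Log_half hk'
      have h6 : Log ((k : ℝ) / 2) ≤ Log2 ((2 : ℝ) ^ k) := Log_mono (by positivity) h3
      linarith
    gcongr
  · exact fun k => gapBound_nonneg _ _ k.cast_nonneg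
  · intro m n hm hmn
    have hm' : (0 : ℝ) < m := by exact_mod_cast hm
    have hmn' : (m : ℝ) ≤ n := by exact_mod_cast hmn
    exact gapBound_anti hε hm' hmn' hm'.le hmn'

lemma gapBound_le_of_le_sq {ε D x : ℝ} (hε : 0 < ε) (hD : 0 ≤ D) (h : D ≤ x * x) :
    gapBound ε D x ≤ (2 * 2 ^ (1 + ε)) * gapBound ε D D := by
  rcases hD.eq_or_lt with rfl | hD
  · simp [gapBound]
  have h1 := (Log_mono hD.le h).trans (Log_sq_le x)
  have h2 := (Log2_mono hD.le h).trans (Log2_sq_le x)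
  have := Log_pos D
  have := Log2_pos D
  have := Log_pos x
  have := Log2_pos x
  have e : (2 * 2 ^ (1 + ε)) * gapBound ε D D
      = 1 / (D * (Log D / 2) * (Log2 D / 2) ^ (1 + ε)) := by
    unfold gapBound
    rw [Real.div_rpow (by positivity) two_pos.le]
    field_simp
  rw [e]
  unfold gapBound
  have : Log D / 2 ≤ Log x := by linarith
  have : Log2 D / 2 ≤ Log2 x := by linarith
  gcongr

/-- Increments of a monotone sequence, weighted by an antitone function evaluated at the
sequence, are summable when the function is. -/
lemma summable_sub_mul_comp {F : ℕ → ℝ} (hF0 : ∀ k, 0 ≤ F k)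
    (hF : ∀ m n, 0 < m → m ≤ n → F n ≤ F m) (hs : Summable F) {d : ℕ → ℕ} (hd : Monotone d) :
    Summable fun N => ((d (N + 1) - d N : ℕ) : ℝ) * F (d (N + 1)) := by
  refine summable_of_sum_range_le (c := ∑' k, F k) (fun N => mul_nonneg (Nat.cast_nonneg _) (hF0 _))
    fun M => ?_
  have key : ∑ N ∈ Finset.range M, ((d (N + 1) - d N : ℕ) : ℝ) * F (d (N + 1))
      ≤ ∑ k ∈ Finset.range (d M + 1), F k := by
    induction M with
    | zero => simpa using Finset.sum_nonneg fun k _ => hF0 k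
    | succ M ih =>
      have hle : d M ≤ d (M + 1) := hd M.le_succ
      rw [Finset.sum_range_succ, ← Finset.sum_range_add_sum_Ico F
        (Nat.succ_le_succ hle)]
      refine add_le_add ih ?_
      have := Finset.card_nsmul_le_sum (Finset.Ico (d M + 1) (d (M + 1) + 1)) F (F (d (M + 1)))
        fun k hk => by
          rw [Finset.mem_Ico] at hk
          exact hF _ _ (by omega) (by omega)
      simpa [nsmul_eq_mul] using this
  exact key.trans (hs.sum_le_tsum _ fun k _ => hF0 k)

lemma nint_eq_norm (x : ℝ) : nint x = ‖(x : UnitAddCircle)‖ := (UnitAddCircle.norm_eq).symm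

lemma nint_neg (x : ℝ) : nint (-x) = nint x := by
  simp [nint_eq_norm]

lemma nint_mul_abs (α x : ℝ) : nint (α * |x|) = nint (α * x) := by
  rcases abs_choice x with h | h <;> rw [h]
  rw [mul_neg, nint_neg]

lemma nint_le_half (x : ℝ) : nint x ≤ 1 / 2 := abs_sub_round x

lemma nint_nonneg (x : ℝ) : 0 ≤ nint x := abs_nonneg _

/-- The set of `α ∈ [0, 1]` for which `α u` is within `t` of an integer has measure `O(t)`,
uniformly for `u` bounded away from `0`. -/
lemma volume_nint_lt_le {η u t : ℝ} (hη : 0 < η) (hu : η ≤ u) (ht : 0 ≤ t) :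
    volume {α : ℝ | α ∈ Set.Icc (0 : ℝ) 1 ∧ nint (α * u) < t}
      ≤ ENNReal.ofReal (2 * (1 + 2 / η) * t) := by
  have hu0 : 0 < u := hη.trans_le hu
  have hsub : {α : ℝ | α ∈ Set.Icc (0 : ℝ) 1 ∧ nint (α * u) < t}
      ⊆ ⋃ k ∈ Finset.range (⌊u⌋₊ + 2), Set.Ioo (((k : ℝ) - t) / u) (((k : ℝ) + t) / u) := by
    rintro α ⟨⟨h0, h1⟩, h⟩
    have hx0 : 0 ≤ α * u := by positivity
    have hx1 : α * u ≤ u := by nlinarith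
    have hr := abs_le.1 (abs_sub_round (α * u))
    have hr0 : 0 ≤ round (α * u) := by
      have : (-1 : ℝ) < round (α * u) := by linarith
      have : (-1 : ℤ) < round (α * u) := by exact_mod_cast this
      omega
    obtain ⟨k, hk⟩ := Int.eq_ofNat_of_zero_le hr0
    have hkr : ((round (α * u) : ℤ) : ℝ) = k := by rw [hk]; simp
    rw [nint, hkr, abs_lt] at h
    rw [hkr] at hr
    simp only [Set.mem_iUnion, Finset.mem_range]
    refine ⟨k, ?_, ?_, ?_⟩
    · have : (k : ℝ) < ((⌊u⌋₊ + 2 : ℕ) : ℝ) := by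
        push_cast
        linarith [Nat.lt_floor_add_one u]
      exact_mod_cast this
    · rw [div_lt_iff₀ hu0]; linarith
    · rw [lt_div_iff₀ hu0]; linarith
  refine (measure_mono hsub).trans ((measure_biUnion_finset_le _ _).trans ?_)
  have hvol (k : ℕ) : volume (Set.Ioo (((k : ℝ) - t) / u) (((k : ℝ) + t) / u))
      = ENNReal.ofReal (2 * t / u) := by
    rw [Real.volume_Ioo]
    congr 1
    ring
  simp only [hvol, Finset.sum_const, Finset.card_range, nsmul_eq_mul]
  rw [← ENNReal.ofReal_natCast, ← ENNReal.ofReal_mul (Nat.cast_nonneg _)]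
  apply ENNReal.ofReal_le_ofReal
  have hfl : ((⌊u⌋₊ + 2 : ℕ) : ℝ) ≤ u + 2 := by
    push_cast
    linarith [Nat.floor_le hu0.le]
  calc ((⌊u⌋₊ + 2 : ℕ) : ℝ) * (2 * t / u) ≤ (u + 2) * (2 * t / u) := by gcongr
    _ = 2 * (1 + 2 / u) * t := by field_simp
    _ ≤ 2 * (1 + 2 / η) * t := by gcongr

/-- The finite set of positive differences `|b_m − b_n|`, `1 ≤ m ≠ n ≤ N`. -/
noncomputable def diffFinset (b : ℕ → ℝ) (N : ℕ) : Finset ℝ :=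
  (Finset.Icc 1 N).offDiag.image fun p => |b p.1 - b p.2|

lemma mem_diffFinset {b : ℕ → ℝ} {N : ℕ} {x : ℝ} : x ∈ diffFinset b N ↔
    ∃ m n : ℕ, 1 ≤ m ∧ m ≤ N ∧ 1 ≤ n ∧ n ≤ N ∧ m ≠ n ∧ x = |b m - b n| := by
  simp only [diffFinset, Finset.mem_image, Finset.mem_offDiag, Finset.mem_Icc, Prod.exists]
  constructor
  · rintro ⟨m, n, ⟨⟨h1, h2⟩, ⟨h3, h4⟩, h5⟩, rfl⟩
    exact ⟨m, n, h1, h2, h3, h4, h5, rfl⟩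
  · rintro ⟨m, n, h1, h2, h3, h4, h5, rfl⟩
    exact ⟨m, n, ⟨⟨h1, h2⟩, ⟨h3, h4⟩, h5⟩, rfl⟩

lemma Dcard_eq_card (b : ℕ → ℝ) (N : ℕ) : Dcard b N = (diffFinset b N).card := by
  rw [Dcard, ← Set.ncard_coe_finset]
  congr 1
  ext x
  simp only [Set.mem_ofPred_eq, Finset.mem_coe, mem_diffFinset]

lemma diffFinset_mono (b : ℕ → ℝ) : Monotone (diffFinset b) := fun _ _ h _ hx => by
  obtain ⟨m, n, h1, h2, h3, h4, h5⟩ := mem_diffFinset.1 hx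
  exact mem_diffFinset.2 ⟨m, n, h1, h2.trans h, h3, h4.trans h, h5⟩

lemma Dcard_mono (b : ℕ → ℝ) : Monotone (Dcard b) := fun _ _ h => by
  rw [Dcard_eq_card, Dcard_eq_card]
  exact Finset.card_le_card (diffFinset_mono b h)

lemma Dcard_le_sq (b : ℕ → ℝ) (N : ℕ) : Dcard b N ≤ N * N := by
  rw [Dcard_eq_card]
  refine Finset.card_image_le.trans ?_
  rw [Finset.offDiag_card]
  simp

lemma Dcard_pos (b : ℕ → ℝ) {N : ℕ} (hN : 2 ≤ N) : 0 < Dcard b N := by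
  rw [Dcard_eq_card, Finset.card_pos]
  exact ⟨_, mem_diffFinset.2 ⟨1, 2, le_rfl, by omega, by omega, hN, by omega, rfl⟩⟩

lemma gapBound_Dcard_anti (b : ℕ → ℝ) {ε : ℝ} (hε : 0 < ε) {M N : ℕ} (hM : 2 ≤ M) (h : M ≤ N) :
    gapBound ε (Dcard b N) N ≤ gapBound ε (Dcard b M) M :=
  gapBound_anti hε (by exact_mod_cast Dcard_pos b hM) (by exact_mod_cast Dcard_mono b h)
    M.cast_nonneg (by exact_mod_cast h)

lemma tendsto_gapBound_Dcard (b : ℕ → ℝ) {ε : ℝ} (hε : 0 < ε) :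
    Tendsto (fun N : ℕ => gapBound ε (Dcard b N) N) atTop (nhds 0) := by
  have hlog : Tendsto (fun N : ℕ => Real.log N) atTop atTop :=
    Real.tendsto_log_atTop.comp tendsto_natCast_atTop_atTop
  refine squeeze_zero' (Eventually.of_forall fun N => gapBound_nonneg _ _ (Nat.cast_nonneg _)) ?_
    hlog.inv_tendsto_atTop
  filter_upwards [eventually_ge_atTop 2, hlog.eventually_ge_atTop 1] with N hN hN1
  have hD : (1 : ℝ) ≤ Dcard b N := by exact_mod_cast Dcard_pos b hN
  have hL : Real.log N ≤ Log N := le_max_right _ _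
  have hL2 : 1 ≤ Log2 (N : ℝ) ^ (1 + ε) := Real.one_le_rpow (one_le_Log2 _) (by linarith)
  have hlp : 0 < Real.log N := by linarith
  have := Log_pos (N : ℝ)
  rw [Pi.inv_apply, gapBound, one_div]
  apply inv_anti₀ hlp
  calc Real.log N = 1 * Real.log N * 1 := by ring
    _ ≤ _ := by gcongr

/-- For `b` uniformly separated, almost every `α` eventually avoids all the sets of
`α` badly approximated by a newly arising difference. -/
lemma ae_eventually_gapBound_le_nint (b : ℕ → ℝ) {η ε : ℝ} (hη : 0 < η) (hε : 0 < ε)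
    (hb : ∀ m n, 1 ≤ m → 1 ≤ n → m ≠ n → η ≤ |b m - b n|) :
    ∀ᵐ α, α ∈ Set.Icc (0 : ℝ) 1 → ∀ᶠ N in atTop,
      ∀ u ∈ diffFinset b (N + 1) \ diffFinset b N,
        gapBound ε (Dcard b (N + 1)) ((N + 1 : ℕ) : ℝ) ≤ nint (α * u) := by
  set E : ℕ → Set ℝ := fun N => ⋃ u ∈ diffFinset b (N + 1) \ diffFinset b N,
    {α : ℝ | α ∈ Set.Icc (0 : ℝ) 1 ∧
      nint (α * u) < gapBound ε (Dcard b (N + 1)) ((N + 1 : ℕ) : ℝ)} with hE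
  set G : ℕ → ℝ := fun N => ((Dcard b (N + 1) - Dcard b N : ℕ) : ℝ) *
    (2 * (1 + 2 / η) * ((2 * 2 ^ (1 + ε)) *
      gapBound ε (Dcard b (N + 1)) (Dcard b (N + 1)))) with hG
  have hGs : Summable G := by
    have h := summable_sub_mul_comp (F := fun k : ℕ => gapBound ε k k)
      (fun k => gapBound_nonneg _ _ k.cast_nonneg)
      (fun m n hm hmn => gapBound_anti hε (by exact_mod_cast hm) (by exact_mod_cast hmn)
        m.cast_nonneg (by exact_mod_cast hmn))
      (summable_gapBound_self hε) (Dcard_mono b)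
    refine (h.mul_left (2 * (1 + 2 / η) * (2 * 2 ^ (1 + ε)))).congr fun N => ?_
    simp only [hG]
    ring
  have hEG : ∀ N, volume (E N) ≤ ENNReal.ofReal (G N) := fun N => by
    refine (measure_biUnion_finset_le _ _).trans ?_
    have hterm : ∀ u ∈ diffFinset b (N + 1) \ diffFinset b N,
        volume {α : ℝ | α ∈ Set.Icc (0 : ℝ) 1 ∧
          nint (α * u) < gapBound ε (Dcard b (N + 1)) ((N + 1 : ℕ) : ℝ)}
        ≤ ENNReal.ofReal (2 * (1 + 2 / η) * ((2 * 2 ^ (1 + ε)) *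
          gapBound ε (Dcard b (N + 1)) (Dcard b (N + 1)))) := fun u hu => by
      obtain ⟨m, n, h1, -, h3, -, h5, rfl⟩ := mem_diffFinset.1 (Finset.mem_sdiff.1 hu).1
      refine (volume_nint_lt_le hη (hb m n h1 h3 h5)
        (gapBound_nonneg _ _ (Nat.cast_nonneg _))).trans (ENNReal.ofReal_le_ofReal ?_)
      have := gapBound_le_of_le_sq hε (D := Dcard b (N + 1)) (x := ((N + 1 : ℕ) : ℝ))
        (Nat.cast_nonneg _) (by exact_mod_cast Dcard_le_sq b (N + 1))
      gcongr
    refine (Finset.sum_le_card_nsmul _ _ _ hterm).trans ?_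
    rw [nsmul_eq_mul, Finset.card_sdiff_of_subset (diffFinset_mono b N.le_succ),
      ← Dcard_eq_card, ← Dcard_eq_card, ← ENNReal.ofReal_natCast,
      ← ENNReal.ofReal_mul (Nat.cast_nonneg _)]
  have hsum : ∑' N, volume (E N) ≠ ⊤ :=
    ne_top_of_le_ne_top hGs.tsum_ofReal_ne_top (ENNReal.tsum_le_tsum hEG)
  filter_upwards [ae_eventually_notMem hsum] with α hα hα01
  filter_upwards [hα] with N hN u hu
  by_contra! hlt
  exact hN (Set.mem_biUnion hu ⟨hα01, hlt⟩)

lemma ae_nint_mul_pos {s : Set ℝ} (hs : s.Countable) (h0 : (0 : ℝ) ∉ s) :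
    ∀ᵐ α, ∀ u ∈ s, 0 < nint (α * u) := by
  rw [ae_ball_iff hs]
  intro u hu
  have hu0 : u ≠ 0 := fun h => h0 (h ▸ hu)
  have hc : (Set.range fun k : ℤ => (k : ℝ) / u).Countable := Set.countable_range _
  filter_upwards [hc.ae_notMem volume] with α hα
  refine (nint_nonneg _).lt_of_ne' fun h => hα ⟨round (α * u), ?_⟩
  rw [nint, abs_eq_zero, sub_eq_zero] at h
  simp only
  rw [← h]
  field_simp

/-- The gap estimate for a uniformly separated sequence. -/
theorem ae_deltaMin_bounds (b : ℕ → ℝ) {η ε : ℝ} (hη : 0 < η) (hε : 0 < ε)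
    (hb : ∀ m n, 1 ≤ m → 1 ≤ n → m ≠ n → η ≤ |b m - b n|) :
    ∀ᵐ α, α ∈ Set.Icc (0 : ℝ) 1 → ∃ N₀ : ℕ, ∀ N, N₀ ≤ N →
      gapBound ε (Dcard b N) N ≤ deltaMin b α N ∧
      deltaMin b α N ≤ 1 - gapBound ε (Dcard b N) N := by
  have hcount : (⋃ N, (diffFinset b N : Set ℝ)).Countable :=
    Set.countable_iUnion fun N => (diffFinset b N).countable_toSet
  have hzero : (0 : ℝ) ∉ ⋃ N, (diffFinset b N : Set ℝ) := by
    rw [Set.mem_iUnion]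
    rintro ⟨N, hN⟩
    obtain ⟨m, n, h1, -, h3, -, h5, h6⟩ := mem_diffFinset.1 hN
    linarith [hb m n h1 h3 h5]
  filter_upwards [ae_eventually_gapBound_le_nint b hη hε hb, ae_nint_mul_pos hcount hzero]
    with α h1 h2 hα
  obtain ⟨N₁, hN₁⟩ := eventually_atTop.1 (h1 hα)
  have hlim := tendsto_gapBound_Dcard b hε
  have hold : ∀ᶠ N : ℕ in atTop, ∀ u ∈ diffFinset b (N₁ + 2),
      gapBound ε (Dcard b N) N ≤ nint (α * u) := by
    rw [Filter.eventually_all_finset]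
    intro u hu
    exact (hlim.eventually_lt_const (h2 u (Set.mem_iUnion.2 ⟨_, hu⟩))).mono fun _ h => h.le
  have hhalf : ∀ᶠ N : ℕ in atTop, gapBound ε (Dcard b N) N < 1 / 2 :=
    hlim.eventually_lt_const (by norm_num)
  obtain ⟨N₀, hN₀⟩ := eventually_atTop.1
    ((hold.and hhalf).and (eventually_ge_atTop (N₁ + 2)))
  refine ⟨N₀, fun N hN => ?_⟩
  obtain ⟨⟨hN2, hN3⟩, hN4⟩ := hN₀ N hN
  have hmain : ∀ K, N₁ + 2 ≤ K → K ≤ N → ∀ u ∈ diffFinset b K,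
      gapBound ε (Dcard b N) N ≤ nint (α * u) := by
    intro K hK
    induction K, hK using Nat.le_induction with
    | base => exact fun _ => hN2
    | succ K hK ih =>
      intro hKN u hu
      by_cases hu' : u ∈ diffFinset b K
      · exact ih (by omega) u hu'
      · exact (gapBound_Dcard_anti b hε (by omega) hKN).trans
          (hN₁ K (by omega) u (Finset.mem_sdiff.2 ⟨hu, hu'⟩))
  constructor
  · refine le_csInf ⟨_, 1, 2, le_rfl, by omega, by omega, by omega, by omega, rfl⟩ ?_
    rintro d ⟨m, n, h1, h2, h3, h4, h5, rfl⟩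
    rw [← nint_mul_abs]
    exact hmain N hN4 le_rfl _ (mem_diffFinset.2 ⟨m, n, h1, h2, h3, h4, h5, rfl⟩)
  · have : deltaMin b α N ≤ nint (α * (b 1 - b 2)) :=
      csInf_le ⟨0, by rintro d ⟨m, n, -, -, -, -, -, rfl⟩; exact nint_nonneg _⟩
        ⟨1, 2, le_rfl, by omega, by omega, by omega, by omega, rfl⟩
    linarith [nint_le_half (α * (b 1 - b 2))]

/-- A function on a half-line whose derivative is bounded away from zero expands distances. -/
lemma mul_abs_sub_le_abs_sub_of_le_abs_deriv {f f' : ℝ → ℝ} {s δ₀ : ℝ}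
    (hf : ∀ x ∈ Set.Ici s, HasDerivWithinAt f (f' x) (Set.Ici s) x)
    (hf' : ∀ x ∈ Set.Ici s, δ₀ ≤ |f' x|) {x y : ℝ} (hx : s ≤ x) (hy : s ≤ y) :
    δ₀ * |x - y| ≤ |f x - f y| := by
  wlog hxy : x ≤ y generalizing x y
  · rw [abs_sub_comm x, abs_sub_comm (f x)]
    exact this hy hx (le_of_not_ge hxy)
  rcases hxy.eq_or_lt with rfl | hlt
  · simp
  obtain ⟨z, hz, hzeq⟩ := exists_hasDerivAt_eq_slope f f' hlt
    (fun z hz => ((hf z (hx.trans hz.1)).continuousWithinAt).mono fun w hw => hx.trans hw.1)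
    (fun z hz => (hf z (hx.trans hz.1.le)).hasDerivAt (Ici_mem_nhds (hx.trans_lt hz.1)))
  have h := hf' z (hx.trans hz.1.le)
  have hpos : 0 < y - x := sub_pos.2 hlt
  rw [hzeq, abs_div, abs_of_pos hpos, le_div_iff₀ hpos] at h
  rwa [abs_sub_comm x, abs_sub_comm (f x), abs_of_pos hpos]

theorem stmt11 (a : ℕ → ℝ) (c : ℝ) (hc : 0 < c)
    (hpos : ∀ n, 1 ≤ n → 0 < a n)
    (hdist : ∀ m n, 1 ≤ m → 1 ≤ n → m ≠ n → a m ≠ a n)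
    (hsep : ∀ m n, 1 ≤ m → 1 ≤ n → m ≠ n → c ≤ |a m - a n|)
    (f f' : ℝ → ℝ) (δ₀ : ℝ) (hδ₀ : 0 < δ₀)
    (hfderiv : ∀ x ∈ Set.Ici (seqInf a),
      HasDerivWithinAt f (f' x) (Set.Ici (seqInf a)) x)
    (hfpos : ∀ n, 1 ≤ n → 0 < f (a n))
    (hf' : ∀ x ∈ Set.Ici (seqInf a), δ₀ ≤ |f' x|)
    (ε : ℝ) (hε : 0 < ε) :
    ∀ᵐ α ∂(volume.restrict (Set.Icc (0:ℝ) 1)),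
      ∃ N₀ : ℕ, ∀ N, N₀ ≤ N →
        1 / ((Dcard (fun n => f (a n)) N : ℝ) * Log (N : ℝ) * Log2 (N : ℝ) ^ (1 + ε)) ≤
            deltaMin (fun n => f (a n)) α N ∧
        deltaMin (fun n => f (a n)) α N ≤
          1 - 1 / ((Dcard (fun n => f (a n)) N : ℝ) * Log (N : ℝ) *
            Log2 (N : ℝ) ^ (1 + ε)) := by
  have hs (n : ℕ) (hn : 1 ≤ n) : seqInf a ≤ a n :=
    csInf_le ⟨0, by rintro x ⟨n, hn, rfl⟩; exact (hpos n hn).le⟩ ⟨n, hn, rfl⟩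
  have hb (m n : ℕ) (hm : 1 ≤ m) (hn : 1 ≤ n) (hmn : m ≠ n) :
      δ₀ * c ≤ |f (a m) - f (a n)| :=
    (mul_le_mul_of_nonneg_left (hsep m n hm hn hmn) hδ₀.le).trans
      (mul_abs_sub_le_abs_sub_of_le_abs_deriv hfderiv hf' (hs m hm) (hs n hn))
  rw [ae_restrict_iff' measurableSet_Icc]
  exact ae_deltaMin_bounds (fun n => f (a n)) (mul_pos hδ₀ hc) hε hb
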